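/- arXiv:1401.4415 — 2 statements merged into one kernel-verified Lean document; each statement's English description precedes it below -/
import Mathlib

section
/- Suppose there exists a constant a > 0 such that c(u) ≥ a for every u ∈ V. Then for every t ∈ (0,1] the t-Aluthge transform equals the weighted shift with weights μ: D(Δ_t(S_λ)) = D(S_μ) and Δ_t(S_λ) f = S_μ f for all f ∈ D(S_μ). -/
open scoped ENNReal NNReal ComplexConjugate Classical ComplexInnerProductSpace

noncomputable section

/-- `HS V` is the Hilbert space `ℓ²(V)` of square-summable families of complex numbers
indexed by `V`. -/
abbrev HS (V : Type*) : Type _ := lp (fun _ : V => ℂ) 2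

/-- A (possibly unbounded) partially defined operator in a Hilbert space `E`: a domain
together with an assignment of values.  Only the restriction of `toFun` to `dom` is
relevant (e.g. via `POp.graph`). -/
structure POp (E : Type*) [NormedAddCommGroup E] [InnerProductSpace ℂ E] where
  dom : Set E
  toFun : E → E

namespace POp

variable {E : Type*} [NormedAddCommGroup E] [InnerProductSpace ℂ E]

/-- Composition of partially defined operators: `(A.comp B) f = A (B f)` on the natural
domain `{f ∈ dom B : B f ∈ dom A}`. -/
def comp (A B : POp E) : POp E :=
  ⟨{f | f ∈ B.dom ∧ B.toFun f ∈ A.dom}, fun f => A.toFun (B.toFun f)⟩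

/-- The graph of a partially defined operator, as a subset of `E × E`. -/
def graph (A : POp E) : Set (E × E) := {p | p.1 ∈ A.dom ∧ p.2 = A.toFun p.1}

/-- The Hilbert-space adjoint of a (densely defined) partially defined operator `A`:
`g ∈ dom A*` iff there is `h` with `⟪A f, g⟫ = ⟪f, h⟫` for all `f ∈ dom A`, and then
`A* g = h` (`h` is unique when `A` is densely defined). -/
def adj (A : POp E) : POp E :=
  ⟨{g | ∃ h : E, ∀ f ∈ A.dom, ⟪A.toFun f, g⟫ = ⟪f, h⟫},
   fun g => if h : ∃ h' : E, ∀ f ∈ A.dom, ⟪A.toFun f, g⟫ = ⟪f, h'⟫ then h.choose else 0⟩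

end POp

variable {V : Type*}

/-- The element of `ℓ²(V)` with coordinates `g` (junk value `0` if `g` is not
square-summable). -/
def mkH (g : V → ℂ) : HS V := if h : Memℓp g 2 then ⟨g, h⟩ else 0

/-- The standard orthonormal basis vector `e_u` of `ℓ²(V)`. -/
def eV (u : V) : HS V := mkH (fun v => if v = u then 1 else 0)

/-- The weighted shift `S_λ` on the directed tree encoded by the parent map `par`
(with `Chi(u) = {v : par v = u}`), with weights `lam`:
domain `{f : Σ_u (Σ_{v ∈ Chi(u)} |λ v|²)·|f u|² < ∞}` and value
`(S_λ f)(v) = λ v · f (par v)`. -/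
def shiftOp (par : V → V) (lam : V → ℂ) : POp (HS V) :=
  ⟨{f | ∑' u : V, ((∑' v : {v : V // par v = u}, ((‖lam v.1‖₊ : ℝ≥0∞) ^ 2)) *
        (‖f u‖₊ : ℝ≥0∞) ^ 2) < ⊤},
   fun f => mkH (fun v => lam v * f (par v))⟩

/-- `cW par lam u = (Σ_{v ∈ Chi(u)} |λ v|²)^{1/2}`, i.e. `c(u) = ‖S_λ e_u‖`. -/
def cW (par : V → V) (lam : V → ℂ) (u : V) : ℝ :=
  Real.sqrt (∑' v : {v : V // par v = u}, ‖lam v.1‖ ^ 2)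

/-- The multiplication operator `M_α` (representing `|S_λ|^α`): domain
`{f : Σ_u c(u)^{2α}·|f u|² < ∞}` and `(M_α f)(u) = c(u)^α·f(u)`. -/
def mulOp (par : V → V) (lam : V → ℂ) (α : ℝ) : POp (HS V) :=
  ⟨{f | Summable fun u : V => cW par lam u ^ (2 * α) * ‖f u‖ ^ 2},
   fun f => mkH (fun u => ((cW par lam u ^ α : ℝ) : ℂ) * f u)⟩

/-- The weights `π` of the partial isometry in the polar decomposition of `S_λ`:
`π v = λ v / c(par v)` if `c(par v) > 0`, and `π v = 0` otherwise. -/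
def piW (par : V → V) (lam : V → ℂ) (v : V) : ℂ :=
  if 0 < cW par lam (par v) then lam v / ((cW par lam (par v) : ℝ) : ℂ) else 0

/-- The partial isometry `S_π` of the polar decomposition of `S_λ`
(a contraction defined on all of `ℓ²(V)`). -/
def piOp (par : V → V) (lam : V → ℂ) : POp (HS V) :=
  ⟨Set.univ, fun f => mkH (fun v => piW par lam v * f (par v))⟩

/-- The weights `μ`: `μ v = (c v / c (par v))^t · λ v` if `c (par v) > 0`, else `0`. -/
def muW (par : V → V) (lam : V → ℂ) (t : ℝ) (v : V) : ℂ :=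
  if 0 < cW par lam (par v)
  then (((cW par lam v / cW par lam (par v)) ^ t : ℝ) : ℂ) * lam v else 0

/-- The `t`-Aluthge transform `Δ_t(S_λ) = M_t ∘ S_π ∘ M_{1-t} = |S_λ|^t S_π |S_λ|^{1-t}`. -/
def aluthge (par : V → V) (lam : V → ℂ) (t : ℝ) : POp (HS V) :=
  ((mulOp par lam t).comp (piOp par lam)).comp (mulOp par lam (1 - t))

theorem tsum_ofReal_ne_top_iff_summable {ι : Type*} {g : ι → ℝ} (hg : ∀ i, 0 ≤ g i) :
    ∑' i, ENNReal.ofReal (g i) ≠ ⊤ ↔ Summable g := by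
  lift g to ι → ℝ≥0 using hg
  simp only [ENNReal.ofReal_coe_nnreal]
  rw [ENNReal.tsum_coe_ne_top_iff_summable, NNReal.summable_coe]

theorem tsum_fiber_mul {ι κ : Type*} (p : ι → κ) (r : ι → ℝ≥0∞) (w : κ → ℝ≥0∞) :
    ∑' u, (∑' v : {v // p v = u}, r v.1) * w u = ∑' v, r v * w (p v) := by
  rw [← (Equiv.sigmaFiberEquiv p).tsum_eq, ENNReal.tsum_sigma']
  refine tsum_congr fun u => ?_
  rw [← ENNReal.tsum_mul_right]
  refine tsum_congr fun v => ?_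
  simp [Equiv.sigmaFiberEquiv, v.2]

theorem memℓp_two_iff_summable_sq (g : V → ℂ) :
    Memℓp g 2 ↔ Summable fun v => ‖g v‖ ^ 2 := by
  rw [memℓp_gen_iff (by norm_num)]
  simp

theorem mkH_apply {g : V → ℂ} (hg : Summable fun v => ‖g v‖ ^ 2) (v : V) :
    mkH g v = g v := by
  rw [mkH, dif_pos ((memℓp_two_iff_summable_sq g).2 hg)]

theorem summable_norm_sq (f : HS V) : Summable fun v => ‖f v‖ ^ 2 :=
  (memℓp_two_iff_summable_sq _).1 (lp.memℓp f)

theorem mem_shiftOp_dom {par : V → V} {nu : V → ℂ} {f : HS V} :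
    f ∈ (shiftOp par nu).dom ↔ Summable fun v => ‖nu v * f (par v)‖ ^ 2 := by
  change ∑' u : V, ((∑' v : {v : V // par v = u}, ((‖nu v.1‖₊ : ℝ≥0∞) ^ 2)) *
        (‖f u‖₊ : ℝ≥0∞) ^ 2) < ⊤ ↔ _
  rw [tsum_fiber_mul par (fun v => (‖nu v‖₊ : ℝ≥0∞) ^ 2) (fun u => (‖f u‖₊ : ℝ≥0∞) ^ 2),
    ← tsum_ofReal_ne_top_iff_summable (fun v => by positivity), lt_top_iff_ne_top]
  simp_rw [ENNReal.ofReal_pow (norm_nonneg _), ofReal_norm, enorm_mul, mul_pow,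
    enorm_eq_nnnorm]

theorem cW_nonneg (par : V → V) (lam : V → ℂ) (u : V) : 0 ≤ cW par lam u :=
  Real.sqrt_nonneg _

theorem summable_norm_sq_mul_comp_par_iff {par : V → V} {lam : V → ℂ}
    (hl : ∀ u : V, Summable fun v : {v : V // par v = u} => ‖lam v.1‖ ^ 2)
    {w : V → ℝ} (hw : ∀ u, 0 ≤ w u) :
    (Summable fun v => ‖lam v‖ ^ 2 * w (par v)) ↔ Summable fun u => cW par lam u ^ 2 * w u := by
  rw [← tsum_ofReal_ne_top_iff_summable fun v => mul_nonneg (sq_nonneg _) (hw _),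
    ← tsum_ofReal_ne_top_iff_summable fun v => mul_nonneg (sq_nonneg _) (hw _)]
  simp_rw [ENNReal.ofReal_mul (sq_nonneg _)]
  rw [← tsum_fiber_mul par (fun v => ENNReal.ofReal (‖lam v‖ ^ 2)) (fun u => ENNReal.ofReal (w u))]
  simp_rw [cW, Real.sq_sqrt (tsum_nonneg fun _ => sq_nonneg _),
    ENNReal.ofReal_tsum_of_nonneg (fun _ => sq_nonneg _) (hl _)]

theorem mem_mulOp_dom {par : V → V} {lam : V → ℂ} {α : ℝ} {f : HS V} :
    f ∈ (mulOp par lam α).dom ↔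
      Summable fun u => ‖((cW par lam u ^ α : ℝ) : ℂ) * f u‖ ^ 2 := by
  change (Summable fun u : V => cW par lam u ^ (2 * α) * ‖f u‖ ^ 2) ↔ _
  refine summable_congr fun u => ?_
  rw [norm_mul, mul_pow, Complex.norm_real, Real.norm_of_nonneg
    (Real.rpow_nonneg (cW_nonneg _ _ _) _), ← Real.rpow_mul_natCast (cW_nonneg _ _ _)]
  congr 2
  push_cast
  ring

theorem mulOp_toFun_apply {par : V → V} {lam : V → ℂ} {α : ℝ} {f : HS V}
    (hf : f ∈ (mulOp par lam α).dom) (u : V) :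
    (mulOp par lam α).toFun f u = ((cW par lam u ^ α : ℝ) : ℂ) * f u :=
  mkH_apply (mem_mulOp_dom.1 hf) u

theorem piW_of_pos {par : V → V} {lam : V → ℂ} (hc : ∀ u, 0 < cW par lam u) (v : V) :
    piW par lam v = lam v / ((cW par lam (par v) : ℝ) : ℂ) :=
  if_pos (hc _)

theorem muW_of_pos {par : V → V} {lam : V → ℂ} (hc : ∀ u, 0 < cW par lam u) (t : ℝ) (v : V) :
    muW par lam t v = (((cW par lam v / cW par lam (par v)) ^ t : ℝ) : ℂ) * lam v :=
  if_pos (hc _)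

theorem piOp_toFun_apply {par : V → V} {lam : V → ℂ}
    (hl : ∀ u : V, Summable fun v : {v : V // par v = u} => ‖lam v.1‖ ^ 2)
    (hc : ∀ u, 0 < cW par lam u) (f : HS V) (v : V) :
    (piOp par lam).toFun f v = piW par lam v * f (par v) := by
  refine mkH_apply (g := fun v => piW par lam v * f (par v)) ?_ v
  have h := (summable_norm_sq_mul_comp_par_iff hl
    (w := fun u => ‖f u‖ ^ 2 / cW par lam u ^ 2) (fun u => by positivity)).2
    ((summable_norm_sq f).congr fun u => by field_simp [(hc u).ne'])
  refine h.congr fun v => ?_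
  rw [piW_of_pos hc, norm_mul, norm_div, Complex.norm_real, Real.norm_of_nonneg (hc _).le]
  ring

/-- The pointwise identity `c(v)^t · π(v) · c(par v)^(1-t) = μ(v)`. -/
theorem cW_rpow_mul_piW_mul {par : V → V} {lam : V → ℂ} (hc : ∀ u, 0 < cW par lam u)
    (t : ℝ) (v : V) :
    ((cW par lam v ^ t : ℝ) : ℂ) * (piW par lam v * ((cW par lam (par v) ^ (1 - t) : ℝ) : ℂ)) =
      muW par lam t v := by
  have h1 : (cW par lam (par v) : ℂ) ≠ 0 := Complex.ofReal_ne_zero.2 (hc _).ne'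
  have h2 : ((cW par lam (par v) ^ t : ℝ) : ℂ) ≠ 0 :=
    Complex.ofReal_ne_zero.2 (Real.rpow_pos_of_pos (hc _) _).ne'
  rw [piW_of_pos hc, muW_of_pos hc, Real.div_rpow (hc _).le (hc _).le,
    Real.rpow_sub (hc _), Real.rpow_one, Complex.ofReal_div, Complex.ofReal_div]
  field_simp

theorem mulOp_piOp_mulOp_apply {par : V → V} {lam : V → ℂ}
    (hl : ∀ u : V, Summable fun v : {v : V // par v = u} => ‖lam v.1‖ ^ 2)
    (hc : ∀ u, 0 < cW par lam u) {t : ℝ} {f : HS V}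
    (hf : f ∈ (mulOp par lam (1 - t)).dom) (v : V) :
    ((cW par lam v ^ t : ℝ) : ℂ) *
        (piOp par lam).toFun ((mulOp par lam (1 - t)).toFun f) v =
      muW par lam t v * f (par v) := by
  rw [piOp_toFun_apply hl hc, mulOp_toFun_apply hf, ← cW_rpow_mul_piW_mul hc]
  ring

theorem mem_mulOp_dom_of_mem_shiftOp_muW_dom {par : V → V} {lam : V → ℂ}
    (hl : ∀ u : V, Summable fun v : {v : V // par v = u} => ‖lam v.1‖ ^ 2)
    {a : ℝ} (ha : 0 < a) (hca : ∀ u : V, a ≤ cW par lam u) {t : ℝ} (ht : 0 ≤ t) {f : HS V}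
    (hf : f ∈ (shiftOp par (muW par lam t)).dom) : f ∈ (mulOp par lam (1 - t)).dom := by
  have hc : ∀ u, 0 < cW par lam u := fun u => ha.trans_le (hca u)
  rw [mem_mulOp_dom]
  have h : Summable fun v => ‖lam v‖ ^ 2 *
      ((cW par lam (par v) ^ t)⁻¹ ^ 2 * ‖f (par v)‖ ^ 2) := by
    refine Summable.of_nonneg_of_le (fun v => by positivity) (fun v => ?_)
      ((mem_shiftOp_dom.1 hf).mul_left ((a ^ t)⁻¹ ^ 2))
    have hle : 1 ≤ (a ^ t)⁻¹ * cW par lam v ^ t := by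
      rw [inv_mul_eq_div, one_le_div (Real.rpow_pos_of_pos ha t)]
      exact Real.rpow_le_rpow ha.le (hca v) ht
    rw [muW_of_pos hc, Real.div_rpow (hc _).le (hc _).le, norm_mul, norm_mul, Complex.norm_real,
      Real.norm_of_nonneg (div_nonneg (Real.rpow_nonneg (hc _).le _)
        (Real.rpow_nonneg (hc _).le _))]
    calc _ = 1 ^ 2 * (‖lam v‖ ^ 2 * ((cW par lam (par v) ^ t)⁻¹ ^ 2 * ‖f (par v)‖ ^ 2)) := by ring
      _ ≤ ((a ^ t)⁻¹ * cW par lam v ^ t) ^ 2 *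
          (‖lam v‖ ^ 2 * ((cW par lam (par v) ^ t)⁻¹ ^ 2 * ‖f (par v)‖ ^ 2)) := by gcongr
      _ = _ := by ring
  refine ((summable_norm_sq_mul_comp_par_iff hl
    (w := fun u => (cW par lam u ^ t)⁻¹ ^ 2 * ‖f u‖ ^ 2) (fun u => by positivity)).1 h).congr
    fun u => ?_
  rw [norm_mul, Complex.norm_real, Real.norm_of_nonneg (Real.rpow_nonneg (hc _).le _),
    Real.rpow_sub (hc _), Real.rpow_one]
  ring

/-- Corollary 4.2: if `c(u) ≥ a > 0` for all `u`, then for every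
`t ∈ (0,1]` one has `Δ_t(S_λ) = S_μ`: `D(Δ_t(S_λ)) = D(S_μ)` and the values agree. -/
theorem statement_7 (V : Type*) [Nonempty V] (par : V → V)
    (ha : ∀ u v : V, ∃ m n : ℕ, par^[m] u = par^[n] v)
    (hb : ∀ (v : V) (n : ℕ), 1 ≤ n → par^[n] v ≠ v)
    (lam : V → ℂ)
    (hl : ∀ u : V, Summable fun v : {v : V // par v = u} => ‖lam v.1‖ ^ 2)
    (a : ℝ) (ha' : 0 < a) (hca : ∀ u : V, a ≤ cW par lam u)
    (t : ℝ) (ht : t ∈ Set.Ioc (0 : ℝ) 1) :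
    (aluthge par lam t).dom = (shiftOp par (muW par lam t)).dom ∧
    ∀ f ∈ (shiftOp par (muW par lam t)).dom,
      (aluthge par lam t).toFun f = (shiftOp par (muW par lam t)).toFun f := by
  have hc : ∀ u, 0 < cW par lam u := fun u => ha'.trans_le (hca u)
  have hdom : (aluthge par lam t).dom = (shiftOp par (muW par lam t)).dom := by
    ext f
    have key (hf : f ∈ (mulOp par lam (1 - t)).dom) :
        (piOp par lam).toFun ((mulOp par lam (1 - t)).toFun f) ∈ (mulOp par lam t).dom ↔
          f ∈ (shiftOp par (muW par lam t)).dom := by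
      rw [mem_mulOp_dom, mem_shiftOp_dom]
      simp_rw [mulOp_piOp_mulOp_apply hl hc hf]
    constructor
    · rintro ⟨h1, -, h2⟩
      exact (key h1).1 h2
    · intro h
      have h1 := mem_mulOp_dom_of_mem_shiftOp_muW_dom hl ha' hca ht.1.le h
      exact ⟨h1, trivial, (key h1).2 h⟩
  refine ⟨hdom, fun f hf => ?_⟩
  have h1 := mem_mulOp_dom_of_mem_shiftOp_muW_dom hl ha' hca ht.1.le hf
  exact congrArg mkH (funext (mulOp_piOp_mulOp_apply hl hc h1))
end
end

section
/- The weighted shift S_λ on the tree V is hyponormal: it is densely defined, D(S_λ) ⊆ D(S_λ*), and ‖S_λ* f‖ ≤ ‖S_λ f‖ for every f ∈ D(S_λ). -/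
open scoped ENNReal NNReal ComplexConjugate Classical ComplexInnerProductSpace

noncomputable section

variable {V : Type*}

/-- The defining property of a vertex of the directed tree of Section 6: there is `M ∈ ℤ`
with `g n ≥ 0` for `n ≤ M`, `g n = -1` for `n > M`, and `g n = 0` for all sufficiently
small `n`.  Such an `M` is unique. -/
def Cond (g : ℤ → ℤ) : Prop :=
  ∃ M : ℤ, (∀ n ≤ M, 0 ≤ g n) ∧ (∀ n, M < n → g n = -1) ∧ ∃ N : ℤ, ∀ n < N, g n = 0

/-- The vertex set `V` of the directed tree of Section 6. -/
def VT : Type := {g : ℤ → ℤ // Cond g}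

/-- `Mv v = M(v)`, the largest index at which `v` differs from `-1`. -/
def Mv (v : VT) : ℤ := v.2.choose

theorem Mv_spec (v : VT) :
    (∀ n ≤ Mv v, 0 ≤ v.1 n) ∧ (∀ n, Mv v < n → v.1 n = -1) ∧ ∃ N : ℤ, ∀ n < N, v.1 n = 0 :=
  v.2.choose_spec

/-- The parent map of the tree of Section 6: `par v` agrees with `v` except at `M(v)`,
where it takes the value `-1` (so that `M(par v) = M(v) - 1`). -/
def parT (v : VT) : VT :=
  ⟨fun n => if n = Mv v then -1 else v.1 n, by
    obtain ⟨h1, h2, N, h3⟩ := Mv_spec v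
    refine ⟨Mv v - 1, fun n hn => ?_, fun n hn => ?_, min N (Mv v), fun n hn => ?_⟩
    · dsimp only; rw [if_neg (by omega)]; exact h1 n (by omega)
    · dsimp only
      by_cases h : n = Mv v
      · rw [if_pos h]
      · rw [if_neg h]; exact h2 n (by omega)
    · have h' := lt_min_iff.mp hn
      dsimp only; rw [if_neg (by omega)]; exact h3 n (by omega)⟩

/-- The weights of Section 6: `λ v = 2^{Σ_{n < M(v)} v(n)} / (v(M(v)) + 1)`
(the sum has finitely many nonzero terms). -/
def lamT (v : VT) : ℂ :=
  (((2 : ℝ) ^ (∑ᶠ n ∈ Set.Iio (Mv v), v.1 n) / ((v.1 (Mv v) : ℝ) + 1)) : ℂ)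

/-- `γ = (Σ_{n=1}^∞ n^{-2})^{1/2}`. -/
def gam : ℝ := Real.sqrt (∑' n : ℕ, (1 : ℝ) / ((n : ℝ) + 1) ^ 2)

theorem memℓp_two_iff_tsum_lt_top (g : V → ℂ) :
    Memℓp g 2 ↔ ∑' v, (‖g v‖₊ : ℝ≥0∞) ^ 2 < ⊤ := by
  have h : ∑' v, (‖g v‖₊ : ℝ≥0∞) ^ 2 = ∑' v, ((‖g v‖₊ ^ 2 : ℝ≥0) : ℝ≥0∞) := by
    simp
  rw [memℓp_gen_iff (by norm_num), h, lt_top_iff_ne_top, ENNReal.tsum_coe_ne_top_iff_summable,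
    ← NNReal.summable_coe]
  simp

theorem HS.enorm_sq_eq_tsum (f : HS V) : (‖f‖₊ : ℝ≥0∞) ^ 2 = ∑' v, (‖f v‖₊ : ℝ≥0∞) ^ 2 := by
  have h := lp.hasSum_norm (p := 2) (by norm_num) f
  simp only [ENNReal.toReal_ofNat, Real.rpow_ofNat] at h
  have h' : HasSum (fun v => ‖f v‖₊ ^ 2) (‖f‖₊ ^ 2) := by
    rw [← NNReal.hasSum_coe]; simpa using h
  simpa using (ENNReal.hasSum_coe.mpr h').tsum_eq.symm

theorem mkH_apply_s11 {g : V → ℂ} (h : Memℓp g 2) (v : V) : mkH g v = g v := by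
  simp [mkH, h]

theorem ENNReal.tsum_fiberwise_eq {W : Type*} (p : V → W) (F : V → ℝ≥0∞) :
    ∑' u, ∑' v : {v // p v = u}, F v.1 = ∑' v, F v := by
  rw [← ENNReal.tsum_sigma' (fun x : Σ u, {v // p v = u} => F x.2.1)]
  exact (Equiv.sigmaFiberEquiv p).tsum_eq F

theorem ENNReal.tsum_mul_sq_le (a b : V → ℝ≥0∞) :
    (∑' v, a v * b v) ^ 2 ≤ (∑' v, a v ^ 2) * ∑' v, b v ^ 2 := by
  have key : ∑' v, a v * b v ≤
      (∑' v, a v ^ 2) ^ (1 / 2 : ℝ) * (∑' v, b v ^ 2) ^ (1 / 2 : ℝ) := by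
    rw [ENNReal.tsum_eq_iSup_sum]
    refine iSup_le fun s => ?_
    refine (ENNReal.inner_le_Lp_mul_Lq s a b Real.HolderConjugate.two_two).trans ?_
    simp only [ENNReal.rpow_ofNat]
    gcongr <;> exact ENNReal.sum_le_tsum s
  calc _ ≤ _ := pow_le_pow_left' key 2
    _ = _ := by
      rw [mul_pow, ← ENNReal.rpow_natCast, ← ENNReal.rpow_natCast, ← ENNReal.rpow_mul,
        ← ENNReal.rpow_mul]
      norm_num

namespace shiftOp

variable {par : V → V} {lam : V → ℂ}

theorem tsum_image_eq (f : HS V) :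
    ∑' v, (‖lam v * f (par v)‖₊ : ℝ≥0∞) ^ 2 =
      ∑' u, (∑' v : {v // par v = u}, (‖lam v.1‖₊ : ℝ≥0∞) ^ 2) * (‖f u‖₊ : ℝ≥0∞) ^ 2 := by
  rw [← ENNReal.tsum_fiberwise_eq par]
  refine tsum_congr fun u => ?_
  rw [← ENNReal.tsum_mul_right]
  refine tsum_congr fun v => ?_
  rw [v.2, nnnorm_mul, ENNReal.coe_mul, mul_pow]

theorem memℓp_of_mem_dom {f : HS V} (hf : f ∈ (shiftOp par lam).dom) :
    Memℓp (fun v => lam v * f (par v)) 2 := by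
  rw [memℓp_two_iff_tsum_lt_top, tsum_image_eq]
  exact hf

theorem toFun_apply {f : HS V} (hf : f ∈ (shiftOp par lam).dom) (v : V) :
    (shiftOp par lam).toFun f v = lam v * f (par v) :=
  mkH_apply_s11 (memℓp_of_mem_dom hf) v

theorem dense_dom (h : ∀ u, ∑' v : {v // par v = u}, (‖lam v.1‖₊ : ℝ≥0∞) ^ 2 ≠ ⊤) :
    Dense (shiftOp par lam).dom := by
  intro f
  have hs := lp.hasSum_single (p := 2) (by norm_num) f
  refine mem_closure_of_tendsto hs (Filter.Eventually.of_forall fun s => ?_)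
  rw [shiftOp, Set.mem_ofPred_eq, tsum_eq_sum (s := s)]
  · exact ENNReal.sum_lt_top.mpr fun u _ =>
      ENNReal.mul_lt_top (h u).lt_top (by simp)
  · intro u hu
    have : (∑ i ∈ s, lp.single 2 i (f i) : HS V) u = 0 := by
      rw [lp.coeFn_sum, Finset.sum_apply]
      refine Finset.sum_eq_zero fun i hi => ?_
      rw [lp.single_apply_ne]
      rintro rfl
      exact hu hi
    rw [this]
    simp

/-- Coordinates of the adjoint of a weighted shift. -/
def adjCoord (par : V → V) (lam : V → ℂ) (f : HS V) (u : V) : ℂ :=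
  ∑' v : {v // par v = u}, conj (lam v.1) * f v.1

theorem inner_toFun_eq {f g : HS V} (hg : g ∈ (shiftOp par lam).dom)
    (hf : Memℓp (adjCoord par lam f) 2) :
    ⟪(shiftOp par lam).toFun g, f⟫ = ⟪g, mkH (adjCoord par lam f)⟫ := by
  have hS := lp.hasSum_inner (𝕜 := ℂ) ((shiftOp par lam).toFun g) f
  rw [← (Equiv.sigmaFiberEquiv par).hasSum_iff] at hS
  rw [← hS.tsum_eq, hS.summable.tsum_sigma, lp.inner_eq_tsum]
  refine tsum_congr fun u => ?_
  rw [mkH_apply_s11 hf, adjCoord, RCLike.inner_apply, mul_comm, ← tsum_mul_left]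
  refine tsum_congr fun v => ?_
  simp only [Function.comp_apply, Equiv.sigmaFiberEquiv, Equiv.coe_fn_mk, toFun_apply hg, v.2,
    RCLike.inner_apply, map_mul]
  ring

theorem tsum_adjCoord_le {w : V → ℝ≥0} (hw : ∀ u, w u ≠ 0)
    (hle : ∀ u, ∑' v : {v // par v = u}, ((‖lam v.1‖₊ / w v.1 : ℝ≥0) : ℝ≥0∞) ^ 2 ≤ 1)
    (f : HS V) :
    ∑' u, (‖adjCoord par lam f u‖₊ : ℝ≥0∞) ^ 2 ≤ ∑' v, (w v : ℝ≥0∞) ^ 2 * (‖f v‖₊ : ℝ≥0∞) ^ 2 := by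
  rw [← ENNReal.tsum_fiberwise_eq par fun v => (w v : ℝ≥0∞) ^ 2 * (‖f v‖₊ : ℝ≥0∞) ^ 2]
  refine ENNReal.tsum_le_tsum fun u => ?_
  calc (‖adjCoord par lam f u‖₊ : ℝ≥0∞) ^ 2
      ≤ (∑' v : {v // par v = u}, ((‖lam v.1‖₊ / w v.1 : ℝ≥0) : ℝ≥0∞) *
          ((w v.1 * ‖f v.1‖₊ : ℝ≥0) : ℝ≥0∞)) ^ 2 := by
        gcongr
        refine (enorm_tsum_le_tsum_enorm
          (f := fun v : {v // par v = u} => conj (lam v.1) * f v.1)).trans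
          (le_of_eq (tsum_congr fun v => ?_))
        rw [← ENNReal.coe_mul, ← mul_assoc, div_mul_cancel₀ _ (hw v.1)]
        simp [enorm_eq_nnnorm, nnnorm_mul]
    _ ≤ _ := ENNReal.tsum_mul_sq_le _ _
    _ ≤ 1 * _ := by gcongr; exact hle u
    _ = _ := by simp [mul_pow]

theorem hyponormal {w : V → ℝ≥0} (hw : ∀ u, w u ≠ 0)
    (heq : ∀ u, ∑' v : {v // par v = u}, (‖lam v.1‖₊ : ℝ≥0∞) ^ 2 = (w u : ℝ≥0∞) ^ 2)
    (hle : ∀ u, ∑' v : {v // par v = u}, ((‖lam v.1‖₊ / w v.1 : ℝ≥0) : ℝ≥0∞) ^ 2 ≤ 1) :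
    Dense (shiftOp par lam).dom ∧
    (shiftOp par lam).dom ⊆ (shiftOp par lam).adj.dom ∧
    ∀ f ∈ (shiftOp par lam).dom,
      ‖(shiftOp par lam).adj.toFun f‖ ≤ ‖(shiftOp par lam).toFun f‖ := by
  have hd : Dense (shiftOp par lam).dom := dense_dom fun u => by simp [heq u]
  have hbound : ∀ f ∈ (shiftOp par lam).dom, ∑' u, (‖adjCoord par lam f u‖₊ : ℝ≥0∞) ^ 2 ≤
      (‖(shiftOp par lam).toFun f‖₊ : ℝ≥0∞) ^ 2 := by
    intro f hf
    refine (tsum_adjCoord_le hw hle f).trans (le_of_eq ?_)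
    rw [HS.enorm_sq_eq_tsum]
    simp only [toFun_apply hf, tsum_image_eq, heq]
  have hmem : ∀ f ∈ (shiftOp par lam).dom, Memℓp (adjCoord par lam f) 2 := fun f hf =>
    (memℓp_two_iff_tsum_lt_top _).mpr ((hbound f hf).trans_lt (by simp))
  have hadj : ∀ f ∈ (shiftOp par lam).dom, ∃ h : HS V, ∀ g ∈ (shiftOp par lam).dom,
      ⟪(shiftOp par lam).toFun g, f⟫ = ⟪g, h⟫ := fun f hf =>
    ⟨_, fun g hg => inner_toFun_eq hg (hmem f hf)⟩
  refine ⟨hd, hadj, fun f hf => ?_⟩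
  have hval : (shiftOp par lam).adj.toFun f = mkH (adjCoord par lam f) := by
    have h := hadj f hf
    simp only [POp.adj, dif_pos h]
    refine hd.eq_of_inner_right ℂ fun g hg => ?_
    rw [← h.choose_spec g hg, inner_toFun_eq hg (hmem f hf)]
  have hsq : (‖(shiftOp par lam).adj.toFun f‖₊ : ℝ≥0∞) ^ 2 ≤
      (‖(shiftOp par lam).toFun f‖₊ : ℝ≥0∞) ^ 2 := by
    rw [hval, HS.enorm_sq_eq_tsum]
    simp only [mkH_apply_s11 (hmem f hf)]
    exact hbound f hf
  exact_mod_cast (ENNReal.pow_le_pow_left_iff two_ne_zero).mp hsq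

end shiftOp

namespace VT

theorem Mv_eq {v : VT} {M : ℤ} (h0 : ∀ n ≤ M, 0 ≤ v.1 n) (h1 : ∀ n, M < n → v.1 n = -1) :
    Mv v = M := by
  obtain ⟨k0, k1, -⟩ := Mv_spec v
  rcases lt_trichotomy (Mv v) M with h | h | h
  · have := k1 M h
    have := h0 M le_rfl
    omega
  · exact h
  · have := h1 _ h
    have := k0 _ le_rfl
    omega

theorem parT_apply (v : VT) (n : ℤ) : (parT v).1 n = if n = Mv v then -1 else v.1 n := rfl

theorem Mv_parT (v : VT) : Mv (parT v) = Mv v - 1 := by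
  obtain ⟨k0, k1, -⟩ := Mv_spec v
  refine Mv_eq (fun n hn => ?_) fun n hn => ?_
  · rw [parT_apply, if_neg (by omega)]
    exact k0 n (by omega)
  · rw [parT_apply]
    split_ifs with h
    · rfl
    · exact k1 n (by omega)

/-- The last nonnegative entry of a vertex. -/
def last (v : VT) : ℕ := (v.1 (Mv v)).toNat

theorem coe_last (v : VT) : (v.last : ℤ) = v.1 (Mv v) :=
  Int.toNat_of_nonneg ((Mv_spec v).1 _ le_rfl)

/-- The sum of all nonnegative entries of a vertex. -/
def total (v : VT) : ℤ := ∑ᶠ n ∈ Set.Iio (Mv v + 1), v.1 n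

theorem finsum_Iio_Mv (v : VT) : ∑ᶠ n ∈ Set.Iio (Mv v), v.1 n = (parT v).total := by
  rw [total, Mv_parT, sub_add_cancel]
  refine finsum_mem_congr rfl fun n hn => ?_
  rw [parT_apply, if_neg (ne_of_lt hn)]

theorem total_eq (v : VT) : v.total = (parT v).total + v.last := by
  have hI : Set.Iio (Mv v + 1) = insert (Mv v) (Set.Iio (Mv v)) := by
    ext n
    simp only [Set.mem_Iio, Set.mem_insert_iff]
    omega
  obtain ⟨-, -, N, hN⟩ := Mv_spec v
  rw [total, hI, finsum_mem_insert' _ (by simp), finsum_Iio_Mv, coe_last, add_comm]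
  refine (Set.finite_Ico N (Mv v)).subset fun n hn => ⟨?_, hn.1⟩
  by_contra! h
  exact hn.2 (hN n h)

theorem exists_child (u : VT) (k : ℕ) : ∃ v : VT, parT v = u ∧ v.last = k := by
  obtain ⟨k0, k1, N, hN⟩ := Mv_spec u
  have h0 : ∀ n ≤ Mv u + 1, 0 ≤ if n = Mv u + 1 then (k : ℤ) else u.1 n := by
    intro n hn
    split_ifs with h
    · omega
    · exact k0 n (by omega)
  have h1 : ∀ n, Mv u + 1 < n → (if n = Mv u + 1 then (k : ℤ) else u.1 n) = -1 := by
    intro n hn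
    rw [if_neg (by omega)]
    exact k1 n (by omega)
  let v : VT := ⟨fun n => if n = Mv u + 1 then (k : ℤ) else u.1 n, Mv u + 1, h0, h1,
    min N (Mv u), fun n hn => by
      have := lt_min_iff.mp hn
      dsimp only
      rw [if_neg (by omega)]
      exact hN n this.1⟩
  have hM : Mv v = Mv u + 1 := Mv_eq h0 h1
  refine ⟨v, Subtype.ext (funext fun n => ?_), ?_⟩
  · rw [parT_apply, hM]
    split_ifs with h
    · exact (k1 n (by omega)).symm
    · exact if_neg h
  · have : v.1 (Mv v) = k := if_pos hM
    simp [last, this]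

theorem bijective_last (u : VT) :
    Function.Bijective fun v : {v // parT v = u} => v.1.last := by
  constructor
  · rintro ⟨v, hv⟩ ⟨v', hv'⟩ h
    have hM : Mv v = Mv v' := by
      have h1 := Mv_parT v
      have h2 := Mv_parT v'
      rw [hv] at h1
      rw [hv'] at h2
      omega
    refine Subtype.ext (Subtype.ext (funext fun n => ?_))
    by_cases hn : n = Mv v
    · have h' : (v.last : ℤ) = v'.last := congrArg Nat.cast h
      rw [coe_last, coe_last, ← hM] at h'
      rw [hn]
      exact h'
    · have h' := congrFun (congrArg Subtype.val (hv.trans hv'.symm)) n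
      rwa [parT_apply, parT_apply, if_neg hn, if_neg (hM ▸ hn)] at h'
  · intro k
    obtain ⟨v, hv, hk⟩ := exists_child u k
    exact ⟨⟨v, hv⟩, hk⟩

theorem tsum_children (u : VT) (F : ℕ → ℝ≥0∞) :
    ∑' v : {v // parT v = u}, F v.1.last = ∑' k, F k :=
  (Equiv.ofBijective _ (bijective_last u)).tsum_eq F

theorem nnnorm_lamT (v : VT) :
    ‖lamT v‖₊ = (2 : ℝ≥0) ^ (parT v).total * ((v.last : ℝ≥0) + 1)⁻¹ := by
  have h : ((v.1 (Mv v) : ℤ) : ℂ) = (v.last : ℂ) := by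
    rw [← coe_last]; simp
  have h2 : ‖(v.last : ℂ) + 1‖₊ = (v.last : ℝ≥0) + 1 := by
    exact_mod_cast RCLike.nnnorm_natCast (K := ℂ) (v.last + 1)
  rw [lamT, finsum_Iio_Mv]
  simp [h, h2, div_eq_mul_inv]

end VT

theorem summable_inv_succ_sq : Summable fun k : ℕ => (((k : ℝ≥0) + 1)⁻¹) ^ 2 := by
  rw [← NNReal.summable_coe]
  have h := (summable_nat_add_iff 1).mpr (Real.summable_nat_pow_inv (p := 2) |>.mpr one_lt_two)
  simpa using h

/-- The sum of the inverse squares of the positive integers. -/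
def invSqSum : ℝ≥0 := ∑' k : ℕ, (((k : ℝ≥0) + 1)⁻¹) ^ 2

theorem invSqSum_ne_zero : invSqSum ≠ 0 := by
  have h : (((0 : ℕ) : ℝ≥0) + 1)⁻¹ ^ 2 ≤ invSqSum :=
    summable_inv_succ_sq.le_tsum 0 fun _ _ => zero_le
  exact (lt_of_lt_of_le (by simp) h).ne'

theorem ennreal_tsum_inv_succ_sq :
    ∑' k : ℕ, ((((k : ℝ≥0) + 1)⁻¹ ^ 2 : ℝ≥0) : ℝ≥0∞) = invSqSum :=
  (ENNReal.coe_tsum summable_inv_succ_sq).symm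

theorem VT.tsum_nnnorm_lamT_sq (u : VT) :
    ∑' v : {v // parT v = u}, (‖lamT v.1‖₊ : ℝ≥0∞) ^ 2 =
      ((2 ^ u.total * NNReal.sqrt invSqSum : ℝ≥0) : ℝ≥0∞) ^ 2 := by
  calc _ = ∑' v : {v // parT v = u}, (((2 ^ u.total) ^ 2 : ℝ≥0) : ℝ≥0∞) *
        ((((v.1.last : ℝ≥0) + 1)⁻¹ ^ 2 : ℝ≥0) : ℝ≥0∞) :=
        tsum_congr fun v => by
          rw [nnnorm_lamT, v.2, ← ENNReal.coe_pow, ← ENNReal.coe_mul, mul_pow]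
    _ = _ := by
      rw [tsum_children u fun k => (((2 ^ u.total) ^ 2 : ℝ≥0) : ℝ≥0∞) *
        ((((k : ℝ≥0) + 1)⁻¹ ^ 2 : ℝ≥0) : ℝ≥0∞), ENNReal.tsum_mul_left, ennreal_tsum_inv_succ_sq,
        ← ENNReal.coe_pow, ← ENNReal.coe_mul, mul_pow, NNReal.sq_sqrt]

theorem VT.tsum_nnnorm_lamT_div_sq_le (u : VT) :
    ∑' v : {v // parT v = u},
      ((‖lamT v.1‖₊ / (2 ^ v.1.total * NNReal.sqrt invSqSum) : ℝ≥0) : ℝ≥0∞) ^ 2 ≤ 1 := by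
  calc _ ≤ ∑' v : {v // parT v = u}, ((invSqSum⁻¹ : ℝ≥0) : ℝ≥0∞) *
        ((((v.1.last : ℝ≥0) + 1)⁻¹ ^ 2 : ℝ≥0) : ℝ≥0∞) := by
        refine ENNReal.tsum_le_tsum fun v => ?_
        rw [← ENNReal.coe_pow, ← ENNReal.coe_mul, ENNReal.coe_le_coe, nnnorm_lamT, div_pow,
          mul_pow, mul_pow, NNReal.sq_sqrt, div_eq_mul_inv, mul_inv]
        have hpow : ((2 : ℝ≥0) ^ (parT v.1).total) ^ 2 * ((2 ^ v.1.total) ^ 2)⁻¹ ≤ 1 := by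
          rw [← div_eq_mul_inv]
          refine div_le_one_of_le₀ ?_ zero_le
          gcongr
          · norm_num
          · have := total_eq v.1
            omega
        calc _ = ((2 : ℝ≥0) ^ (parT v.1).total) ^ 2 * ((2 ^ v.1.total) ^ 2)⁻¹ *
              (invSqSum⁻¹ * ((v.1.last : ℝ≥0) + 1)⁻¹ ^ 2) := by ring
          _ ≤ _ := mul_le_of_le_one_left zero_le hpow
    _ = 1 := by
      rw [tsum_children u fun k => ((invSqSum⁻¹ : ℝ≥0) : ℝ≥0∞) *
        ((((k : ℝ≥0) + 1)⁻¹ ^ 2 : ℝ≥0) : ℝ≥0∞), ENNReal.tsum_mul_left, ennreal_tsum_inv_succ_sq,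
        ← ENNReal.coe_mul, inv_mul_cancel₀ invSqSum_ne_zero, ENNReal.coe_one]

/-- Proposition 6.2: the weighted shift `S_λ` on the tree of Section 6
is hyponormal: it is densely defined, `D(S_λ) ⊆ D(S_λ*)`, and `‖S_λ* f‖ ≤ ‖S_λ f‖` for
every `f ∈ D(S_λ)`. -/
theorem statement_11 :
    Dense (shiftOp parT lamT).dom ∧
    (shiftOp parT lamT).dom ⊆ (shiftOp parT lamT).adj.dom ∧
    ∀ f ∈ (shiftOp parT lamT).dom,
      ‖(shiftOp parT lamT).adj.toFun f‖ ≤ ‖(shiftOp parT lamT).toFun f‖ :=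
  shiftOp.hyponormal
    (fun _ => mul_ne_zero (zpow_ne_zero _ two_ne_zero)
      (NNReal.sqrt_eq_zero.not.mpr invSqSum_ne_zero))
    VT.tsum_nnnorm_lamT_sq VT.tsum_nnnorm_lamT_div_sq_le
end
end
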